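/- arXiv:1607.08116 — 2 statements merged into one kernel-verified Lean document; each statement's English description precedes it below -/
import Mathlib

section
/- Let w : Fin n → ℝ be a vector with strictly positive entries and let D be the consistent pairwise comparison matrix D_{ij} = w_i / w_j. For any real s > n, set N = (1/s)·D. Then I − N is invertible, the total relation matrix T = N(I − N)^{-1} equals (s/(s − n))·N, all entries of T are strictly positive, and √(T_{ij}/T_{ji}) = D_{ij} for all i, j. In particular, the DEMATEL-based completion transformation applied to T recovers the consistent matrix D exactly. -/
namespace Matrix

theorem of_div_mul_self {ι K : Type*} [Fintype ι] [Field K] {w : ι → K} (hw : ∀ i, w i ≠ 0) :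
    (of fun i j => w i / w j) * (of fun i j => w i / w j) =
      (Fintype.card ι : K) • of fun i j => w i / w j := by
  ext i j
  simp [mul_apply, div_mul_div_cancel₀ (hw _)]

variable {ι K : Type*} [Fintype ι] [DecidableEq ι] [Field K] {N : Matrix ι ι K} {r : K}

theorem one_sub_mul_of_mul_self_eq_smul (hN : N * N = r • N) (hr : r ≠ 1) :
    (1 - N) * (1 + (1 - r)⁻¹ • N) = 1 := by
  have hr' : 1 - r ≠ 0 := sub_ne_zero.mpr hr.symm
  have h : (1 - r)⁻¹ - 1 - (1 - r)⁻¹ * r = 0 := by field_simp; ring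
  calc (1 - N) * (1 + (1 - r)⁻¹ • N)
      = 1 + ((1 - r)⁻¹ - 1 - (1 - r)⁻¹ * r) • N := by
        simp only [sub_mul, mul_add, mul_smul_comm, hN, one_mul, mul_one]
        module
    _ = 1 := by simp [h]

theorem mul_one_sub_inv_of_mul_self_eq_smul (hN : N * N = r • N) (hr : r ≠ 1) :
    N * (1 - N)⁻¹ = (1 - r)⁻¹ • N := by
  have hr' : 1 - r ≠ 0 := sub_ne_zero.mpr hr.symm
  have h : 1 + (1 - r)⁻¹ * r = (1 - r)⁻¹ := by field_simp; ring
  rw [inv_eq_right_inv (one_sub_mul_of_mul_self_eq_smul hN hr), mul_add, mul_one, mul_smul_comm,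
    hN, smul_smul, ← h, add_smul, one_smul, h]

end Matrix


/-- For a consistent pairwise comparison matrix `D i j = w i / w j` (with `w` positive) and
any scale `s > n`, the normalization `N = s⁻¹ • D` satisfies: `I - N` is invertible, the
total relation matrix `T = N * (I - N)⁻¹` equals `(s / (s - n)) • N`, all entries of `T`
are strictly positive, and `√(T i j / T j i) = D i j`; i.e. the DEMATEL-based completion
transformation recovers `D` exactly. -/
theorem dematel_recovers_consistent_matrix (n : ℕ) (w : Fin n → ℝ) (hw : ∀ i, 0 < w i)
    (D N T : Matrix (Fin n) (Fin n) ℝ)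
    (hD : D = Matrix.of fun i j => w i / w j)
    (s : ℝ) (hs : (n : ℝ) < s)
    (hN : N = s⁻¹ • D) (hT : T = N * (1 - N)⁻¹) :
    IsUnit (1 - N) ∧ T = (s / (s - n)) • N ∧ (∀ i j, 0 < T i j) ∧
      (∀ i j, Real.sqrt (T i j / T j i) = D i j) := by
  have hs₀ : 0 < s := n.cast_nonneg.trans_lt hs
  have hsn : 0 < s - n := sub_pos.mpr hs
  have hNN : N * N = (n / s) • N := by
    rw [hN, smul_mul_smul_comm, hD, Matrix.of_div_mul_self fun i => (hw i).ne', Fintype.card_fin,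
      smul_smul, smul_smul]
    congr 1
    ring
  have hr : n / s ≠ 1 := ((div_lt_one hs₀).mpr hs).ne
  have hTN : T = (s / (s - n)) • N := by
    rw [hT, Matrix.mul_one_sub_inv_of_mul_self_eq_smul hNN hr, one_sub_div hs₀.ne', inv_div]
  have hT_apply (i j) : T i j = (s - n)⁻¹ * (w i / w j) := by
    simp only [hTN, hN, hD, Matrix.smul_apply, Matrix.of_apply, smul_eq_mul]
    field_simp
  refine ⟨.of_mul_eq_one _ (Matrix.one_sub_mul_of_mul_self_eq_smul hNN hr), hTN,
    fun i j => ?_, fun i j => ?_⟩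
  · rw [hT_apply]
    exact mul_pos (inv_pos.mpr hsn) (div_pos (hw i) (hw j))
  · have hi := hw i
    have hj := hw j
    have h : T i j / T j i = (w i / w j) ^ 2 := by
      rw [hT_apply, hT_apply]
      field_simp
    rw [h, Real.sqrt_sq (div_pos hi hj).le, hD, Matrix.of_apply]
end

section
/- Let A be an n×n real pairwise comparison matrix, i.e. A_{ij} > 0 and A_{ij}·A_{ji} = 1 for all i, j. If w is a vector with strictly positive entries such that A·w = n·w, then A_{ij} = w_i / w_j for all i, j; that is, A is consistent and its consistency index CI = (λ − n)/(n − 1) vanishes exactly in the consistent case. -/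
/-- A positive matrix with reciprocal entries and all row sums equal to its size has all entries
equal to one. -/
theorem reciprocal_eq_one_of_row_sums_eq_card {ι : Type*} [Fintype ι] (B : ι → ι → ℝ)
    (hpos : ∀ i j, 0 < B i j) (hrec : ∀ i j, B i j * B j i = 1)
    (hsum : ∀ i, ∑ j, B i j = Fintype.card ι) (i j : ι) : B i j = 1 := by
  have hnonneg : ∀ i j, 0 ≤ B i j + B j i - 2 := fun i j => by
    nlinarith [sq_nonneg (B i j - B j i), hrec i j, hpos i j, hpos j i]
  have htotal : ∑ i, ∑ j, (B i j + B j i - 2) = 0 := by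
    simp only [Finset.sum_sub_distrib, Finset.sum_add_distrib]
    rw [Finset.sum_comm (f := fun i j => B j i)]
    simp only [hsum, Finset.sum_const, Finset.card_univ, nsmul_eq_mul]
    ring
  have hrow := (Finset.sum_eq_zero_iff_of_nonneg
    fun i _ => Finset.sum_nonneg fun j _ => hnonneg i j).1 htotal i (Finset.mem_univ i)
  have hentry := (Finset.sum_eq_zero_iff_of_nonneg
    fun j _ => hnonneg i j).1 hrow j (Finset.mem_univ j)
  have hji : B j i = 2 - B i j := by linarith
  have hprod := hrec i j
  rw [hji] at hprod
  have hsq : (B i j - 1) ^ 2 = 0 := by linarith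
  exact sub_eq_zero.1 (pow_eq_zero_iff two_ne_zero |>.1 hsq)

/-- If a pairwise comparison matrix `A` (positive entries with `A i j * A j i = 1`) has a
strictly positive eigenvector `w` with eigenvalue exactly `n`, then `A i j = w i / w j` for
all `i, j`; that is, `A` is consistent. -/
theorem eigenvalue_eq_card_implies_consistent (n : ℕ) (A : Matrix (Fin n) (Fin n) ℝ)
    (hpos : ∀ i j, 0 < A i j) (hrec : ∀ i j, A i j * A j i = 1)
    (w : Fin n → ℝ) (hw : ∀ i, 0 < w i)
    (heig : A.mulVec w = (n : ℝ) • w) :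
    ∀ i j, A i j = w i / w j := by
  intro i j
  have hne : ∀ i, w i ≠ 0 := fun i => (hw i).ne'
  have hone := reciprocal_eq_one_of_row_sums_eq_card (fun i j => A i j * w j / w i)
    (fun i j => div_pos (mul_pos (hpos i j) (hw j)) (hw i))
    (fun i j => by
      have := hne i
      have := hne j
      field_simp
      exact hrec i j)
    (fun i => by
      rw [← Finset.sum_div, div_eq_iff (hne i), Fintype.card_fin]
      exact congrFun heig i) i j
  rw [eq_div_iff (hne j)]
  exact (div_eq_one_iff_eq (hne i)).1 hone
end
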